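/- arXiv:1911.05858 — 8 statements merged into one kernel-verified Lean document; each statement's English description precedes it below -/
import Mathlib

section
/- Let A be an invertible square matrix over a field 𝔽 indexed by a finite type ι, let B = A⁻¹, and let S ⊆ ι with complement S̄ = ι \ S. Then rank(B_{S̄,S}) = rank(A_{S̄,S}) and rank(B_{S,S̄}) = rank(A_{S,S̄}), where M_{T,T'} denotes the submatrix of M with rows indexed by T and columns indexed by T'. -/
open Matrix

/-- If the first block column of a product of `2 × 2` block matrices is that of the identity,
then the lower left block of the left factor has rank at most that of the right factor. -/
theorem Matrix.rank_lower_left_le_of_block_mul_eq_one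
    {K m n : Type*} [Field K] [Fintype m] [Fintype n] [DecidableEq m]
    {P E : Matrix m m K} {Q : Matrix m n K} {R G : Matrix n m K} {T : Matrix n n K}
    (h₁ : P * E + Q * G = 1) (h₂ : R * E + T * G = 0) : R.rank ≤ G.rank := by
  have mem_ker {x : m → K} (hx : x ∈ LinearMap.ker G.mulVecLin) :
      E.mulVecLin x ∈ LinearMap.ker R.mulVecLin := by
    have hx' : G *ᵥ x = 0 := hx
    have h := congrArg (· *ᵥ x) h₂
    simpa [add_mulVec, ← mulVec_mulVec, hx'] using h
  have inj : Function.Injective (E.mulVecLin.restrict fun _ hx ↦ mem_ker hx) := by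
    rw [← LinearMap.ker_eq_bot, LinearMap.ker_eq_bot']
    rintro ⟨x, hx⟩ hEx
    have hx' : G *ᵥ x = 0 := hx
    have hEx' : E *ᵥ x = 0 := congrArg Subtype.val hEx
    have h := congrArg (· *ᵥ x) h₁
    ext1
    simpa [add_mulVec, ← mulVec_mulVec, hx', hEx'] using h.symm
  have hle := LinearMap.finrank_le_finrank_of_injective inj
  have hG := G.mulVecLin.finrank_range_add_finrank_ker
  have hR := R.mulVecLin.finrank_range_add_finrank_ker
  unfold rank
  lia

/-- If `A * B = 1`, then off-diagonal blocks of `A` have rank at most that of the corresponding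
blocks of `B`. -/
theorem Matrix.rank_toBlock_le_of_mul_eq_one {K ι : Type*} [Field K] [Fintype ι] [DecidableEq ι]
    {A B : Matrix ι ι K} (h : A * B = 1) (p q : ι → Prop) [Fintype {i // p i}] [Fintype {i // q i}]
    (hpq : ∀ i, q i ↔ ¬ p i) : (A.toBlock q p).rank ≤ (B.toBlock q p).rank := by
  classical
  obtain rfl : q = fun i ↦ ¬ p i := funext fun i ↦ propext (hpq i)
  have mul_eq_add (r : ι → Prop) : (A * B).toBlock r p =
      A.toBlock r p * B.toBlock p p + A.toBlock r (fun i ↦ ¬ p i) * B.toBlock (fun i ↦ ¬ p i) p := by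
    convert toBlock_mul_eq_add r p p A B
  apply rank_lower_left_le_of_block_mul_eq_one (P := A.toBlock p p) (E := B.toBlock p p)
    (Q := A.toBlock p fun i ↦ ¬ p i) (T := A.toBlock (fun i ↦ ¬ p i) fun i ↦ ¬ p i)
  · rw [← mul_eq_add, h, toBlock_one_self]
  · rw [← mul_eq_add, h]
    exact toBlock_one_disjoint (disjoint_compl_left (a := p))

/-- For an invertible matrix `A` over a field and its inverse `B = A⁻¹`,
the ranks of the off-diagonal blocks `B_{S̄,S}`, `B_{S,S̄}` equal those of
`A_{S̄,S}`, `A_{S,S̄}` respectively. -/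
theorem hankel_block_rank_invariant_under_inversion
    {𝔽 ι : Type*} [Field 𝔽] [Fintype ι] [DecidableEq ι]
    (A B : Matrix ι ι 𝔽) (hA : IsUnit A) (hB : B = A⁻¹) (S : Finset ι) :
    (B.submatrix (fun i : {i : ι // i ∉ S} => (i : ι))
        (fun j : {j : ι // j ∈ S} => (j : ι))).rank =
      (A.submatrix (fun i : {i : ι // i ∉ S} => (i : ι))
        (fun j : {j : ι // j ∈ S} => (j : ι))).rank ∧
    (B.submatrix (fun i : {i : ι // i ∈ S} => (i : ι))
        (fun j : {j : ι // j ∉ S} => (j : ι))).rank =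
      (A.submatrix (fun i : {i : ι // i ∈ S} => (i : ι))
        (fun j : {j : ι // j ∉ S} => (j : ι))).rank := by
  subst hB
  have hdet := (isUnit_iff_isUnit_det A).mp hA
  have hAB := mul_nonsing_inv A hdet
  have hBA := nonsing_inv_mul A hdet
  have hS : ∀ i, i ∈ S ↔ ¬ i ∉ S := fun _ ↦ not_not.symm
  exact ⟨(rank_toBlock_le_of_mul_eq_one hBA (· ∈ S) (· ∉ S) fun _ ↦ Iff.rfl).antisymm
      (rank_toBlock_le_of_mul_eq_one hAB (· ∈ S) (· ∉ S) fun _ ↦ Iff.rfl),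
    (rank_toBlock_le_of_mul_eq_one hBA (· ∉ S) (· ∈ S) hS).antisymm
      (rank_toBlock_le_of_mul_eq_one hAB (· ∉ S) (· ∈ S) hS)⟩
end

section
/- Let (A,G) be a graph-partitioned matrix that is GIRS-c, and suppose A is invertible. Then (A⁻¹, G) is GIRS-c, i.e., for every subset S ⊆ V, rank((A⁻¹)_{S̄,S}) ≤ c·ρ(S). -/
open Matrix

variable {𝔽 : Type*} [Field 𝔽] {V : Type*} [Fintype V] [DecidableEq V]

/-- The Hankel block `A_{S̄,S}` of a graph-partitioned matrix: rows whose block index lies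
outside `S`, columns whose block index lies in `S`. -/
def hankelBlock {N : V → ℕ}
    (A : Matrix ((v : V) × Fin (N v)) ((v : V) × Fin (N v)) 𝔽) (S : Finset V) :
    Matrix {p : (v : V) × Fin (N v) // p.1 ∉ S} {p : (v : V) × Fin (N v) // p.1 ∈ S} 𝔽 :=
  Matrix.of fun i j => A i.1 j.1

/-- `ρ(S)`: the number of edges of `G` with exactly one endpoint in `S` (each such edge is
counted once, as the ordered pair with first endpoint outside `S`). -/
def borderEdges (G : SimpleGraph V) [DecidableRel G.Adj] (S : Finset V) : ℕ :=
  (Finset.univ.filter fun p : V × V => G.Adj p.1 p.2 ∧ p.1 ∉ S ∧ p.2 ∈ S).card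

/-- The pair `(A, G)` has the graph-induced rank structure property with constant `c`. -/
def IsGIRS (G : SimpleGraph V) [DecidableRel G.Adj] {N : V → ℕ}
    (A : Matrix ((v : V) × Fin (N v)) ((v : V) × Fin (N v)) 𝔽) (c : ℕ) : Prop :=
  ∀ S : Finset V, (hankelBlock A S).rank ≤ c * borderEdges G S

/-- If `A` maps the kernel of `C` injectively into the kernel of `D`, as witnessed by the two
block identities, then `D` has at most the rank of `C`. -/
theorem rank_le_rank_of_mul_add_mul {R m n : Type*} [Field R] [Fintype m] [Fintype n]
    [DecidableEq m] {A E : Matrix m m R} {F : Matrix m n R} {C D : Matrix n m R}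
    {H : Matrix n n R} (h₁ : E * A + F * C = 1) (h₂ : D * A + H * C = 0) :
    D.rank ≤ C.rank := by
  have hmaps : ∀ x ∈ LinearMap.ker C.mulVecLin, A.mulVecLin x ∈ LinearMap.ker D.mulVecLin := by
    intro x hx
    have hx' : C *ᵥ x = 0 := by simpa using hx
    simpa [add_mulVec, ← mulVec_mulVec, hx'] using congrArg (· *ᵥ x) h₂
  have hinj : Function.Injective (A.mulVecLin.restrict hmaps) := by
    rw [← LinearMap.ker_eq_bot, LinearMap.ker_eq_bot']
    rintro ⟨x, hx⟩ hAx
    have hx' : C *ᵥ x = 0 := by simpa using hx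
    have hAx' : A *ᵥ x = 0 := congrArg Subtype.val hAx
    have h := congrArg (· *ᵥ x) h₁
    simp only [add_mulVec, ← mulVec_mulVec, hx', hAx', mulVec_zero, add_zero, one_mulVec] at h
    exact Subtype.ext h.symm
  have hker := LinearMap.finrank_le_finrank_of_injective hinj
  have hC := C.mulVecLin.finrank_range_add_finrank_ker
  have hD := D.mulVecLin.finrank_range_add_finrank_ker
  unfold Matrix.rank
  omega

/-- The off-diagonal blocks of the inverse of a matrix have at most the rank of the corresponding
blocks of the matrix. -/
theorem rank_toBlock_inv_le {R n : Type*} [Field R] [Fintype n] [DecidableEq n]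
    (A : Matrix n n R) (hA : IsUnit A) (p : n → Prop) [DecidablePred p] :
    (A⁻¹.toBlock (fun i => ¬p i) p).rank ≤ (A.toBlock (fun i => ¬p i) p).rank := by
  have hinv : A⁻¹ * A = 1 := nonsing_inv_mul A ((isUnit_iff_isUnit_det A).mp hA)
  apply rank_le_rank_of_mul_add_mul (A := A.toBlock p p) (E := A⁻¹.toBlock p p)
    (F := A⁻¹.toBlock p fun i => ¬p i) (H := A⁻¹.toBlock (fun i => ¬p i) fun i => ¬p i)
  · rw [← toBlock_mul_eq_add, hinv, toBlock_one_self]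
  · rw [← toBlock_mul_eq_add, hinv, toBlock_one_disjoint]
    exact disjoint_compl_left


/-- If `(A, G)` is GIRS-`c` and `A` is invertible, then `(A⁻¹, G)` is
GIRS-`c`. -/
theorem isGIRS_inv (G : SimpleGraph V) [DecidableRel G.Adj] {N : V → ℕ}
    (A : Matrix ((v : V) × Fin (N v)) ((v : V) × Fin (N v)) 𝔽) (c : ℕ)
    (hA : IsUnit A) (h : IsGIRS G A c) : IsGIRS G A⁻¹ c := by
  exact fun S => (rank_toBlock_inv_le A hA (fun p => p.1 ∈ S)).trans (h S)
end

section
/- Let (A,G) be a graph-partitioned matrix that is GIRS-c and (B,G) a graph-partitioned matrix (with the same graph and block sizes) that is GIRS-d. Then (AB, G) is GIRS-(c+d), i.e., for every subset S ⊆ V, rank((AB)_{S̄,S}) ≤ (c+d)·ρ(S). -/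
open Matrix

variable {𝔽 : Type*} [Field 𝔽] {V : Type*} [Fintype V] [DecidableEq V]

theorem Matrix.rank_add_le {m n K : Type*} [Fintype n] [Field K]
    (A B : Matrix m n K) : (A + B).rank ≤ A.rank + B.rank := by
  unfold Matrix.rank
  rw [mulVecLin_add]
  exact (Submodule.finrank_mono (LinearMap.range_add_le _ _)).trans
    (Submodule.finrank_add_le_finrank_add_finrank _ _)

/-- If `(A, G)` is GIRS-`c` and `(B, G)` is GIRS-`d`, then `(A * B, G)` is
GIRS-`(c + d)`. -/
theorem isGIRS_mul (G : SimpleGraph V) [DecidableRel G.Adj] {N : V → ℕ}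
    (A B : Matrix ((v : V) × Fin (N v)) ((v : V) × Fin (N v)) 𝔽) (c d : ℕ)
    (hA : IsGIRS G A c) (hB : IsGIRS G B d) : IsGIRS G (A * B) (c + d) := by
  intro S
  have key : hankelBlock (A * B) S =
      hankelBlock A S * B.toBlock (fun p => p.1 ∈ S) (fun p => p.1 ∈ S) +
        A.toBlock (fun p => p.1 ∉ S) (fun p => p.1 ∉ S) * hankelBlock B S := by
    let q : (v : V) × Fin (N v) → Prop := fun p => p.1 ∈ S
    exact toBlock_mul_eq_add (fun p => ¬ q p) q q A B
  rw [key, add_mul]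
  exact (rank_add_le _ _).trans (add_le_add ((rank_mul_le_left _ _).trans (hA S))
    ((rank_mul_le_right _ _).trans (hB S)))
end

section
/- Let A be an n × n matrix over a field 𝔽 (indexed by Fin n) with bandwidth k, i.e., A_{ij} = 0 whenever |i − j| > k. Let L be the line graph on Fin n with edge set {{i, i+1} : 0 ≤ i ≤ n−2}. Then (A, L) is GIRS-k: for every subset S ⊆ Fin n, rank(A_{S̄,S}) ≤ k·ρ_L(S), where ρ_L(S) is the number of indices i with exactly one of i, i+1 in S. -/
open Matrix

/-- The rank of matrices is subadditive. -/
theorem Matrix.rank_add_le_rank_add_rank {m n 𝔽 : Type*} [Fintype m] [Fintype n] [Field 𝔽]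
    (M N : Matrix m n 𝔽) : (M + N).rank ≤ M.rank + N.rank := by
  have hrange : LinearMap.range (M + N).mulVecLin ≤
      LinearMap.range M.mulVecLin ⊔ LinearMap.range N.mulVecLin := by
    rintro _ ⟨x, rfl⟩
    rw [mulVecLin_add]
    exact Submodule.add_mem_sup ⟨x, rfl⟩ ⟨x, rfl⟩
  exact (Submodule.finrank_mono hrange).trans
    (Submodule.finrank_add_le_finrank_add_finrank _ _)

/-- If every nonzero entry of `M` lies in a row of `R` or a column of `C`, then the rank of `M` is
at most the number of these lines. -/
theorem Matrix.rank_le_card_add_card_of_cover {m n 𝔽 : Type*} [Fintype m] [Fintype n] [Field 𝔽]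
    (M : Matrix m n 𝔽) (R : Finset m) (C : Finset n)
    (h : ∀ i j, i ∉ R → j ∉ C → M i j = 0) : M.rank ≤ R.card + C.card := by
  classical
  have hM : M = diagonal (fun i => if i ∈ R then (1 : 𝔽) else 0) * M +
      (diagonal (fun i => if i ∈ R then (0 : 𝔽) else 1) * M) *
        diagonal (fun j => if j ∈ C then (1 : 𝔽) else 0) := by
    ext i j
    by_cases hi : i ∈ R <;> by_cases hj : j ∈ C <;>
      simp [hi, hj, diagonal_mul, mul_diagonal, h]
  have hR : (diagonal (fun i => if i ∈ R then (1 : 𝔽) else 0)).rank = R.card := by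
    simp [rank_diagonal]
  have hC : (diagonal (fun j => if j ∈ C then (1 : 𝔽) else 0)).rank = C.card := by
    simp [rank_diagonal]
  rw [hM]
  refine (rank_add_le_rank_add_rank _ _).trans (add_le_add ?_ ?_)
  · exact (rank_mul_le_left _ _).trans hR.le
  · exact (rank_mul_le_right _ _).trans hC.le

/-- A predicate on `Fin n` with different truth values at `a < b` changes its value at two
consecutive indices between `a` and `b`. -/
theorem Fin.exists_consecutive_of_not_iff {n : ℕ} (P : Fin n → Prop) {a b : Fin n} (hab : a < b)
    (h : ¬(P a ↔ P b)) :
    ∃ p q : Fin n, (p : ℕ) + 1 = q ∧ a ≤ p ∧ p < b ∧ ¬(P p ↔ P q) := by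
  obtain ⟨b, hb⟩ := b
  induction b with
  | zero => exact absurd hab (Nat.not_lt_zero _)
  | succ c ih =>
    have hac : (a : ℕ) ≤ c := Nat.lt_succ_iff.mp hab
    by_cases hc : P a ↔ P ⟨c, by omega⟩
    · exact ⟨⟨c, by omega⟩, ⟨c + 1, hb⟩, rfl, hac, Nat.lt_succ_self c, by rwa [← hc]⟩
    · have hlt : a < ⟨c, by omega⟩ := by
        refine lt_of_le_of_ne hac ?_
        intro hac_eq
        exact hc (iff_of_eq (congrArg P hac_eq))
      obtain ⟨p, q, hpq, hap, hpc, hP⟩ := ih (by omega) hlt hc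
      exact ⟨p, q, hpq, hap, hpc.trans (Nat.lt_succ_self c), hP⟩

/-- At most `k` indices lie in the window of length `k` ending at `p`. -/
theorem Fin.card_filter_le_and_lt_add_le {n : ℕ} (k : ℕ) (p : Fin n) :
    (Finset.univ.filter fun i : Fin n => i ≤ p ∧ (p : ℕ) < i + k).card ≤ k := by
  refine (Finset.card_le_card_of_injOn (t := Finset.range k) (fun i : Fin n => (p : ℕ) - i)
    ?_ ?_).trans (Finset.card_range k).le
  · intro i hi
    simp only [Finset.coe_filter, Finset.mem_univ, true_and, Set.mem_ofPred_eq, Fin.le_def] at hi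
    simp only [Finset.coe_range, Set.mem_Iio]
    omega
  · intro i hi j hj hij
    simp only [Finset.coe_filter, Finset.mem_univ, true_and, Set.mem_ofPred_eq, Fin.le_def] at hi hj
    dsimp only at hij
    omega

/-- A banded matrix with bandwidth `k` is GIRS-`k` with respect to the line
graph on `Fin n` (whose edges are the pairs `{i, i+1}`): for every subset `S ⊆ Fin n`,
`rank(A_{S̄,S}) ≤ k · ρ_L(S)`, with `ρ_L(S)` the number of indices `i` such that exactly one
of `i`, `i+1` lies in `S`. -/
theorem banded_isGIRS_line
    {𝔽 : Type*} [Field 𝔽] {n k : ℕ} (A : Matrix (Fin n) (Fin n) 𝔽)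
    (hband : ∀ i j : Fin n, (k : ℤ) < |(i : ℤ) - (j : ℤ)| → A i j = 0)
    (S : Finset (Fin n)) :
    (A.submatrix (fun i : {i : Fin n // i ∉ S} => (i : Fin n))
        (fun j : {j : Fin n // j ∈ S} => (j : Fin n))).rank ≤
      k * (Finset.univ.filter fun p : Fin n × Fin n =>
        (p.1 : ℕ) + 1 = (p.2 : ℕ) ∧
          ((p.1 ∈ S ∧ p.2 ∉ S) ∨ (p.2 ∈ S ∧ p.1 ∉ S))).card := by
  classical
  set E := Finset.univ.filter fun p : Fin n × Fin n =>
    (p.1 : ℕ) + 1 = (p.2 : ℕ) ∧ ((p.1 ∈ S ∧ p.2 ∉ S) ∨ (p.2 ∈ S ∧ p.1 ∉ S)) with hE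
  let C : Finset (Fin n) := E.biUnion fun p =>
    Finset.univ.filter fun i : Fin n => i ≤ p.1 ∧ (p.1 : ℕ) < i + k
  have hcard : C.card ≤ k * E.card := by
    rw [mul_comm]
    exact Finset.card_biUnion_le_card_mul _ _ _ fun p _ => Fin.card_filter_le_and_lt_add_le k p.1
  have hcover : ∀ a b : Fin n, a < b → ¬(a ∈ S ↔ b ∈ S) → (b : ℕ) ≤ a + k → a ∈ C := by
    intro a b hab hS hk
    obtain ⟨p, q, hpq, hap, hpb, hP⟩ := Fin.exists_consecutive_of_not_iff (· ∈ S) hab hS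
    refine Finset.mem_biUnion.mpr ⟨(p, q), ?_, ?_⟩
    · simp only [hE, Finset.mem_filter, Finset.mem_univ, true_and]
      exact ⟨hpq, by tauto⟩
    · simp only [Finset.mem_filter, Finset.mem_univ, true_and]
      exact ⟨hap, by rw [Fin.lt_def] at hpb; omega⟩
  refine (rank_le_card_add_card_of_cover _ (C.subtype (· ∉ S)) (C.subtype (· ∈ S)) ?_).trans ?_
  · rintro ⟨i, hi⟩ ⟨j, hj⟩ hiC hjC
    rw [Finset.mem_subtype] at hiC hjC
    refine hband i j ?_
    by_contra hk
    rw [not_lt, abs_le] at hk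
    rcases lt_trichotomy i j with hij | rfl | hij
    · exact hiC (hcover i j hij (by tauto) (by omega))
    · exact hi hj
    · exact hjC (hcover j i hij (by tauto) (by omega))
  · rw [Finset.card_subtype, Finset.card_subtype, add_comm,
      Finset.card_filter_add_card_filter_not]
    exact hcard
end

section
/- Fix m ≥ 2 and set N = m². Let A be the N × N real matrix of the 2D discrete Poisson problem on an m × m grid in row-major (natural) order: indexing rows and columns by p, q ∈ {0, 1, …, N−1}, A_{pq} = 4 if p = q; A_{pq} = −1 if |p − q| = 1 and ⌊p/m⌋ = ⌊q/m⌋; A_{pq} = −1 if |p − q| = m; and A_{pq} = 0 otherwise. Then for every i with 1 ≤ i ≤ N−1, the rank of the lower Hankel block of A with rows indexed by {i, i+1, …, N−1} and columns indexed by {0, 1, …, i−1} equals min(i, m, N−i). -/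
open Matrix

/-- The `N × N` matrix (with `N = m²`) of the 2D discrete Poisson problem on an `m × m` grid
in row-major (natural) order. -/
noncomputable def poissonMatrix (m : ℕ) : Matrix (Fin (m * m)) (Fin (m * m)) ℝ :=
  Matrix.of fun p q =>
    if p = q then 4
    else if ((p : ℤ) - (q : ℤ)).natAbs = 1 ∧ (p : ℕ) / m = (q : ℕ) / m then -1
    else if ((p : ℤ) - (q : ℤ)).natAbs = m then -1
    else 0

theorem poissonMatrix_of_eq_add {m : ℕ} (hm : 2 ≤ m) {p q : Fin (m * m)}
    (h : (p : ℕ) = q + m) : poissonMatrix m p q = -1 := by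
  have hpq : p ≠ q := by
    rintro rfl
    omega
  have h1 : ((p : ℤ) - (q : ℤ)).natAbs ≠ 1 := by omega
  have hd : ((p : ℤ) - (q : ℤ)).natAbs = m := by omega
  simp only [poissonMatrix, of_apply]
  rw [if_neg hpq, if_neg fun h => h1 h.1, if_pos hd]

/-- The lower bandwidth of the Poisson matrix is at most `m`. -/
theorem poissonMatrix_of_add_lt {m : ℕ} (hm : 2 ≤ m) {p q : Fin (m * m)}
    (h : (q : ℕ) + m < p) : poissonMatrix m p q = 0 := by
  have hpq : p ≠ q := by
    rintro rfl
    omega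
  have h1 : ((p : ℤ) - (q : ℤ)).natAbs ≠ 1 := by omega
  have hd : ((p : ℤ) - (q : ℤ)).natAbs ≠ m := by omega
  simp only [poissonMatrix, of_apply]
  rw [if_neg hpq, if_neg fun h => h1 h.1, if_neg hd]

/-- For the 2D discrete Poisson matrix on an `m × m` grid (`m ≥ 2`,
`N = m²`) and every `1 ≤ i ≤ N − 1`, the lower Hankel block with rows `{i, …, N−1}` and
columns `{0, …, i−1}` has rank exactly `min(i, m, N − i)`. -/
theorem poisson_lower_hankel_rank (m : ℕ) (hm : 2 ≤ m) (i : ℕ)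
    (hi1 : 1 ≤ i) (hi2 : i ≤ m * m - 1) :
    ((poissonMatrix m).submatrix
        (fun p : {p : Fin (m * m) // i ≤ (p : ℕ)} => (p : Fin (m * m)))
        (fun q : {q : Fin (m * m) // (q : ℕ) < i} => (q : Fin (m * m)))).rank =
      min i (min m (m * m - i)) := by
  have hmm : 2 * m ≤ m * m := Nat.mul_le_mul_right m hm
  apply le_antisymm
  · refine le_min ?_ ?_
    · refine (rank_le_card_width _).trans ?_
      have hinj : Function.Injective
          (fun q : {q : Fin (m * m) // (q : ℕ) < i} => (⟨q, q.2⟩ : Fin i)) := by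
        intro a b hab
        exact Subtype.ext (Fin.ext (Fin.mk.inj hab))
      simpa only [Fintype.card_fin] using Fintype.card_le_of_injective _ hinj
    · refine (rank_le_card_of_support_subset _
        (Finset.univ.filter fun p : {p : Fin (m * m) // i ≤ (p : ℕ)} => (p : ℕ) < i + m)
        ?_).trans ?_
      · intro p hp
        by_contra hlt
        simp only [Finset.coe_filter, Finset.mem_univ, true_and, Set.mem_ofPred_eq,
          not_lt] at hlt
        refine hp (funext fun q => ?_)
        have hq := q.2
        have hqp : ((q : Fin (m * m)) : ℕ) + m < (p : Fin (m * m)) := by omega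
        exact poissonMatrix_of_add_lt hm hqp
      · have hcard : (Finset.Ico i (min (i + m) (m * m))).card = min m (m * m - i) := by
          rw [Nat.card_Ico]
          omega
        rw [← hcard]
        refine Finset.card_le_card_of_injOn (fun p => (p : ℕ)) ?_ ?_
        · intro p hp
          have hp1 := p.2
          have hp2 := p.1.2
          have hp3 := (Finset.mem_filter.mp hp).2
          simp only [Finset.coe_Ico, Set.mem_Ico]
          omega
        · intro a _ b _ hab
          exact Subtype.ext (Fin.ext hab)
  · -- Shifting the `m`-th subdiagonal to the main diagonal gives an upper triangular minor.
    set r := min i (min m (m * m - i))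
    let row : Fin r → {p : Fin (m * m) // i ≤ (p : ℕ)} := fun j =>
      ⟨⟨i - m + j + m, by omega⟩, by dsimp only; omega⟩
    let col : Fin r → {q : Fin (m * m) // (q : ℕ) < i} := fun k =>
      ⟨⟨i - m + k, by omega⟩, by dsimp only; omega⟩
    set B := (poissonMatrix m).submatrix
      (fun p : {p : Fin (m * m) // i ≤ (p : ℕ)} => (p : Fin (m * m)))
      (fun q : {q : Fin (m * m) // (q : ℕ) < i} => (q : Fin (m * m)))
    have htri : (B.submatrix row col).IsUpperTriangular := by
      intro j k hkj
      have hlt : (k : ℕ) < j := hkj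
      refine poissonMatrix_of_add_lt hm ?_
      dsimp only [row, col]
      omega
    have hdet : (B.submatrix row col).det ≠ 0 := by
      rw [det_of_isUpperTriangular htri]
      refine Finset.prod_ne_zero_iff.mpr fun j _ => ?_
      have hdiag : B.submatrix row col j j = -1 := poissonMatrix_of_eq_add hm rfl
      rw [hdiag]
      norm_num
    have hle := rank_submatrix_le B row col
    rwa [rank_of_det_ne_zero hdet, Fintype.card_fin] at hle
end

section
/- Let A be a block matrix over a field 𝔽 with n ≥ 1 block rows/columns and block sizes N : Fin n → ℕ. Then there exists an SSS representation of A whose dimensions are exactly the Hankel block ranks: r^h_i = rank(𝓗_i) and r^g_i = rank(𝓖_i) for all 1 ≤ i ≤ n−1. In particular, if for a graph G equal to the line graph on Fin n the pair (A,G) is GIRS-r (so that ρ of each contiguous initial segment equals 1), then there is an SSS representation of A with all dimensions r^h_i, r^g_i ≤ r. -/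
open Matrix

variable {𝔽 : Type*} [Field 𝔽]

/-- The product of `d` consecutive transition matrices `W k * W (k+1) * ⋯ * W (k+d-1)`. -/
def sssChainAux (rg : ℕ → ℕ) (W : ∀ j, Matrix (Fin (rg j)) (Fin (rg (j + 1))) 𝔽) (k : ℕ) :
    (d : ℕ) → Matrix (Fin (rg k)) (Fin (rg (k + d))) 𝔽
  | 0 => (1 : Matrix (Fin (rg k)) (Fin (rg k)) 𝔽)
  | d + 1 => sssChainAux rg W k d * W (k + d)

/-- The product of the transition matrices `W k * W (k+1) * ⋯ * W (ℓ-1)` (the identity when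
`k = ℓ`, and junk `0` when `ℓ < k`). -/
def sssChain (rg : ℕ → ℕ) (W : ∀ j, Matrix (Fin (rg j)) (Fin (rg (j + 1))) 𝔽) (k ℓ : ℕ) :
    Matrix (Fin (rg k)) (Fin (rg ℓ)) 𝔽 :=
  if h : k ≤ ℓ then Nat.add_sub_cancel' h ▸ sssChainAux rg W k (ℓ - k) else 0

/-- A sequentially semi-separable (SSS) representation of a block matrix `A` (with `n` block
rows/columns, block `k` of size `N k`, blocks indexed from `0`) with dimensions `rg`, `rh`
(`rg c`, `rh c` being the state dimensions at the cut between blocks `c` and `c + 1`, for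
`0 ≤ c ≤ n - 2`): the diagonal blocks of `A` are `D k`; the strictly upper blocks are
`A_{k ℓ} = U k * W k * W (k+1) * ⋯ * W (ℓ - 2) * (V ℓ)ᵀ` for `k < ℓ`; and the strictly lower
blocks are `A_{k ℓ} = P k * R (k-2) * R (k-3) * ⋯ * R ℓ * (Q ℓ)ᵀ` for `ℓ < k`. -/
def IsSSSRep {n : ℕ} (N : ℕ → ℕ)
    (A : Matrix ((k : Fin n) × Fin (N k)) ((k : Fin n) × Fin (N k)) 𝔽)
    (rg rh : ℕ → ℕ)
    (U : ∀ k, Matrix (Fin (N k)) (Fin (rg k)) 𝔽)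
    (W : ∀ j, Matrix (Fin (rg j)) (Fin (rg (j + 1))) 𝔽)
    (V : ∀ k, Matrix (Fin (N k)) (Fin (rg (k - 1))) 𝔽)
    (D : ∀ k, Matrix (Fin (N k)) (Fin (N k)) 𝔽)
    (P : ∀ k, Matrix (Fin (N k)) (Fin (rh (k - 1))) 𝔽)
    (R : ∀ j, Matrix (Fin (rh (j + 1))) (Fin (rh j)) 𝔽)
    (Q : ∀ k, Matrix (Fin (N k)) (Fin (rh k)) 𝔽) : Prop :=
  (∀ (k : Fin n) (i j : Fin (N k)), A ⟨k, i⟩ ⟨k, j⟩ = D k i j) ∧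
  (∀ (k ℓ : Fin n), (k : ℕ) < (ℓ : ℕ) → ∀ (i : Fin (N k)) (j : Fin (N ℓ)),
      A ⟨k, i⟩ ⟨ℓ, j⟩ = (U k * sssChain rg W k ((ℓ : ℕ) - 1) * (V ℓ)ᵀ) i j) ∧
  (∀ (k ℓ : Fin n), (ℓ : ℕ) < (k : ℕ) → ∀ (i : Fin (N k)) (j : Fin (N ℓ)),
      A ⟨k, i⟩ ⟨ℓ, j⟩ =
        (P k * (sssChain rh (fun j => (R j)ᵀ) ℓ ((k : ℕ) - 1))ᵀ * (Q ℓ)ᵀ) i j)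

/-- The lower Hankel block `𝓗` at cut `c`: rows in blocks `{c+1, …, n-1}`, columns in blocks
`{0, …, c}`. -/
def lowerHankelBlock {n : ℕ} (N : ℕ → ℕ)
    (A : Matrix ((k : Fin n) × Fin (N k)) ((k : Fin n) × Fin (N k)) 𝔽) (c : ℕ) :
    Matrix {p : (k : Fin n) × Fin (N k) // c < (p.1 : ℕ)}
      {p : (k : Fin n) × Fin (N k) // (p.1 : ℕ) ≤ c} 𝔽 :=
  Matrix.of fun i j => A i.1 j.1

/-- The upper Hankel block `𝓖` at cut `c`: rows in blocks `{0, …, c}`, columns in blocks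
`{c+1, …, n-1}`. -/
def upperHankelBlock {n : ℕ} (N : ℕ → ℕ)
    (A : Matrix ((k : Fin n) × Fin (N k)) ((k : Fin n) × Fin (N k)) 𝔽) (c : ℕ) :
    Matrix {p : (k : Fin n) × Fin (N k) // (p.1 : ℕ) ≤ c}
      {p : (k : Fin n) × Fin (N k) // c < (p.1 : ℕ)} 𝔽 :=
  Matrix.of fun i j => A i.1 j.1

/-- The Hankel block `A_{S̄,S}` of a block matrix for a subset `S` of block indices. -/
def blockHankel {n : ℕ} (N : ℕ → ℕ)
    (A : Matrix ((k : Fin n) × Fin (N k)) ((k : Fin n) × Fin (N k)) 𝔽) (S : Finset (Fin n)) :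
    Matrix {p : (k : Fin n) × Fin (N k) // p.1 ∉ S}
      {p : (k : Fin n) × Fin (N k) // p.1 ∈ S} 𝔽 :=
  Matrix.of fun i j => A i.1 j.1

/-- `ρ_L(S)` for the line graph on `Fin n` with edges `{k, k+1}`: the number of edges with
exactly one endpoint in `S`. -/
def lineBorder (n : ℕ) (S : Finset (Fin n)) : ℕ :=
  (Finset.univ.filter fun p : Fin n × Fin n =>
    (p.1 : ℕ) + 1 = (p.2 : ℕ) ∧ ¬((p.1 ∈ S) ↔ (p.2 ∈ S))).card

/-- A matrix of rank `r` is fixed by a projection onto its column space that factors through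
dimension `r`. -/
theorem exists_mul_mul_eq_self_of_rank {m l : Type*} [Fintype m] [Fintype l] [DecidableEq m]
    (M : Matrix m l 𝔽) :
    ∃ (X : Matrix m (Fin M.rank) 𝔽) (Z : Matrix (Fin M.rank) m 𝔽), X * (Z * M) = M := by
  classical
  obtain ⟨p, hp⟩ := (LinearMap.range M.mulVecLin).subtype.exists_leftInverse_of_injective
    (Submodule.ker_subtype _)
  have e : LinearMap.range M.mulVecLin ≃ₗ[𝔽] (Fin M.rank → 𝔽) :=
    LinearEquiv.ofFinrankEq _ _ (Module.finrank_fin_fun 𝔽).symm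
  refine ⟨LinearMap.toMatrix' ((LinearMap.range M.mulVecLin).subtype ∘ₗ e.symm.toLinearMap),
    LinearMap.toMatrix' (e.toLinearMap ∘ₗ p), ?_⟩
  apply Matrix.toLin'.injective
  refine LinearMap.ext fun v => ?_
  have hpM : p (M *ᵥ v) = ⟨M *ᵥ v, ⟨v, rfl⟩⟩ :=
    LinearMap.congr_fun hp ⟨M *ᵥ v, ⟨v, rfl⟩⟩
  simp [Matrix.toLin'_mul, hpM]

theorem sssChain_add (rg : ℕ → ℕ) (W : ∀ j, Matrix (Fin (rg j)) (Fin (rg (j + 1))) 𝔽)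
    (k d : ℕ) : sssChain rg W k (k + d) = sssChainAux rg W k d := by
  have key (d' : ℕ) (hd : d' = d) (h : k + d' = k + d) :
      (h ▸ sssChainAux rg W k d' : Matrix (Fin (rg k)) (Fin (rg (k + d))) 𝔽) =
        sssChainAux rg W k d := by
    subst hd
    rfl
  rw [sssChain, dif_pos (Nat.le_add_right k d)]
  exact key _ (Nat.add_sub_cancel_left _ _) _

theorem sssChain_self (rg : ℕ → ℕ) (W : ∀ j, Matrix (Fin (rg j)) (Fin (rg (j + 1))) 𝔽)
    (k : ℕ) : sssChain rg W k k = 1 :=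
  sssChain_add rg W k 0

theorem sssChain_succ (rg : ℕ → ℕ) (W : ∀ j, Matrix (Fin (rg j)) (Fin (rg (j + 1))) 𝔽)
    {k l : ℕ} (h : k ≤ l) : sssChain rg W k (l + 1) = sssChain rg W k l * W l := by
  obtain ⟨d, rfl⟩ := Nat.exists_eq_add_of_le h
  rw [sssChain_add]
  exact sssChain_add rg W k (d + 1)

/-- Factorization of the upper Hankel block through its rank, extended by zero to all indices. -/
theorem exists_upperHankelBlock_factor {n : ℕ} (N : ℕ → ℕ)
    (A : Matrix ((k : Fin n) × Fin (N k)) ((k : Fin n) × Fin (N k)) 𝔽) (c : ℕ) :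
    ∃ (X : Matrix ((k : Fin n) × Fin (N k)) (Fin (upperHankelBlock N A c).rank) 𝔽)
      (Z : Matrix (Fin (upperHankelBlock N A c).rank) ((k : Fin n) × Fin (N k)) 𝔽),
      (∀ i j, (i.1 : ℕ) ≤ c → c < (j.1 : ℕ) → A i j = (X * (Z * A)) i j) ∧
      ∀ a i, c < (i.1 : ℕ) → Z a i = 0 := by
  obtain ⟨X, Z, h⟩ := exists_mul_mul_eq_self_of_rank (upperHankelBlock N A c)
  refine ⟨.of fun i a => if hi : (i.1 : ℕ) ≤ c then X ⟨i, hi⟩ a else 0,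
    .of fun a i => if hi : (i.1 : ℕ) ≤ c then Z a ⟨i, hi⟩ else 0, ?_, ?_⟩
  · intro i j hi hj
    have hij := congr_fun (congr_fun h ⟨i, hi⟩) ⟨j, hj⟩
    simp only [Matrix.mul_apply, Matrix.of_apply] at hij ⊢
    refine hij.symm.trans (Finset.sum_congr rfl fun a _ => ?_)
    rw [dif_pos hi]
    congr 1
    refine Fintype.sum_of_injective Subtype.val Subtype.val_injective _ _ ?_ ?_
    · intro p hp
      rw [dif_neg fun hp' => hp ⟨⟨p, hp'⟩, rfl⟩, zero_mul]
    · intro p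
      rw [dif_pos p.2]
      rfl
  · intro a i hi
    exact dif_neg (not_le.mpr hi)

/-- The upper half of the SSS representation with dimensions the upper Hankel block ranks. -/
theorem exists_upper_sss {n : ℕ} (N : ℕ → ℕ)
    (A : Matrix ((k : Fin n) × Fin (N k)) ((k : Fin n) × Fin (N k)) 𝔽) (rg : ℕ → ℕ)
    (hrg : ∀ c, rg c = (upperHankelBlock N A c).rank) :
    ∃ (U : ∀ k, Matrix (Fin (N k)) (Fin (rg k)) 𝔽)
      (W : ∀ j, Matrix (Fin (rg j)) (Fin (rg (j + 1))) 𝔽)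
      (V : ∀ k, Matrix (Fin (N k)) (Fin (rg (k - 1))) 𝔽),
      ∀ (k ℓ : Fin n), (k : ℕ) < (ℓ : ℕ) → ∀ (i : Fin (N k)) (j : Fin (N ℓ)),
        A ⟨k, i⟩ ⟨ℓ, j⟩ = (U k * sssChain rg W k ((ℓ : ℕ) - 1) * (V ℓ)ᵀ) i j := by
  obtain rfl : rg = fun c => (upperHankelBlock N A c).rank := funext hrg
  choose X Z hXZ hZ using exists_upperHankelBlock_factor N A
  let W (c : ℕ) := Z c * X (c + 1)
  have hW (c : ℕ) (a) (j : (k : Fin n) × Fin (N k)) (hj : c + 1 < (j.1 : ℕ)) :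
      (Z c * A) a j = (W c * (Z (c + 1) * A)) a j := by
    rw [Matrix.mul_assoc, Matrix.mul_apply, Matrix.mul_apply]
    refine Finset.sum_congr rfl fun i _ => ?_
    rcases le_or_gt (i.1 : ℕ) c with hi | hi
    · rw [hXZ (c + 1) i j (by omega) hj]
    · rw [hZ c a i hi, zero_mul, zero_mul]
  let U (k : ℕ) : Matrix (Fin (N k)) (Fin (upperHankelBlock N A k).rank) 𝔽 :=
    .of fun i a => if hk : k < n then X k ⟨⟨k, hk⟩, i⟩ a else 0
  refine ⟨U, W,
    fun k => .of fun j a => if hk : k < n then (Z (k - 1) * A) a ⟨⟨k, hk⟩, j⟩ else 0, ?_⟩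
  intro k ℓ hkℓ i j
  have hchain (c : ℕ) (hkc : (k : ℕ) ≤ c) (hc : c < (ℓ : ℕ)) :
      A ⟨k, i⟩ ⟨ℓ, j⟩ =
        ((U k * sssChain _ W k c : Matrix _ _ 𝔽) * (Z c * A : Matrix _ _ 𝔽)) i ⟨ℓ, j⟩ := by
    induction c, hkc using Nat.le_induction with
    | base =>
      rw [sssChain_self, Matrix.mul_one, hXZ k ⟨k, i⟩ ⟨ℓ, j⟩ le_rfl hc, Matrix.mul_apply,
        Matrix.mul_apply]
      simp [U]
    | succ c hkc ih =>
      rw [ih (by omega), sssChain_succ _ _ hkc, ← Matrix.mul_assoc (U k),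
        Matrix.mul_assoc _ (W c), Matrix.mul_apply, Matrix.mul_apply]
      exact Finset.sum_congr rfl fun a _ => by rw [hW c a ⟨ℓ, j⟩ hc]
  rw [hchain (ℓ - 1) (by omega) (by omega), Matrix.mul_apply, Matrix.mul_apply]
  simp

theorem exists_sss_rep_rank {n : ℕ} (N : ℕ → ℕ)
    (A : Matrix ((k : Fin n) × Fin (N k)) ((k : Fin n) × Fin (N k)) 𝔽) :
    ∃ U W V D P R Q, IsSSSRep N A (fun c => (upperHankelBlock N A c).rank)
      (fun c => (lowerHankelBlock N A c).rank) U W V D P R Q := by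
  obtain ⟨U, W, V, hU⟩ := exists_upper_sss N A _ fun _ => rfl
  obtain ⟨Q, R, P, hL⟩ := exists_upper_sss N Aᵀ (fun c => (lowerHankelBlock N A c).rank)
    fun c => Matrix.rank_transpose (upperHankelBlock N Aᵀ c)
  refine ⟨U, W, V, fun k i j => if hk : k < n then A ⟨⟨k, hk⟩, i⟩ ⟨⟨k, hk⟩, j⟩ else 0,
    P, fun j => (R j)ᵀ, Q, ?_, hU, ?_⟩
  · intro k i j
    simp
  · intro k ℓ h i j
    refine (hL ℓ k h j i).trans ?_
    simp only [Matrix.transpose_transpose]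
    rw [← Matrix.transpose_apply (_ * _), Matrix.transpose_mul, Matrix.transpose_mul,
      Matrix.transpose_transpose, Matrix.mul_assoc]

theorem lineBorder_initial {n c : ℕ} (hc : c < n - 1) :
    lineBorder n (Finset.univ.filter fun k : Fin n => (k : ℕ) ≤ c) = 1 := by
  rw [lineBorder, Finset.card_eq_one]
  refine ⟨(⟨c, by omega⟩, ⟨c + 1, by omega⟩), ?_⟩
  ext ⟨a, b⟩
  simp only [Finset.mem_filter, Finset.mem_univ, true_and, Finset.mem_singleton, Prod.mk.injEq,
    Fin.ext_iff]
  omega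

theorem lineBorder_compl (n : ℕ) (S : Finset (Fin n)) : lineBorder n Sᶜ = lineBorder n S := by
  simp only [lineBorder, Finset.mem_compl, not_iff_not]

theorem rank_lowerHankelBlock {n : ℕ} (N : ℕ → ℕ)
    (A : Matrix ((k : Fin n) × Fin (N k)) ((k : Fin n) × Fin (N k)) 𝔽) (c : ℕ) :
    (lowerHankelBlock N A c).rank =
      (blockHankel N A (Finset.univ.filter fun k : Fin n => (k : ℕ) ≤ c)).rank :=
  Matrix.rank_submatrix (blockHankel N A (Finset.univ.filter fun k : Fin n => (k : ℕ) ≤ c))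
    (Equiv.subtypeEquivRight fun p => by simp) (Equiv.subtypeEquivRight fun p => by simp)

theorem rank_upperHankelBlock {n : ℕ} (N : ℕ → ℕ)
    (A : Matrix ((k : Fin n) × Fin (N k)) ((k : Fin n) × Fin (N k)) 𝔽) (c : ℕ) :
    (upperHankelBlock N A c).rank =
      (blockHankel N A (Finset.univ.filter fun k : Fin n => (k : ℕ) ≤ c)ᶜ).rank :=
  Matrix.rank_submatrix (blockHankel N A (Finset.univ.filter fun k : Fin n => (k : ℕ) ≤ c)ᶜ)
    (Equiv.subtypeEquivRight fun p => by simp) (Equiv.subtypeEquivRight fun p => by simp)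

/-- Every block matrix `A` admits an SSS representation whose dimensions are
exactly the Hankel block ranks `rh c = rank 𝓗_c`, `rg c = rank 𝓖_c` at every cut
`0 ≤ c < n - 1`. In particular, if `(A, L)` is GIRS-`r` for the line graph `L` on the `n`
block indices, then `A` admits an SSS representation with all dimensions at most `r`. -/
theorem exists_sss_rep {n : ℕ} (hn : 1 ≤ n) (N : ℕ → ℕ)
    (A : Matrix ((k : Fin n) × Fin (N k)) ((k : Fin n) × Fin (N k)) 𝔽) :
    (∃ (rg rh : ℕ → ℕ)
        (U : ∀ k, Matrix (Fin (N k)) (Fin (rg k)) 𝔽)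
        (W : ∀ j, Matrix (Fin (rg j)) (Fin (rg (j + 1))) 𝔽)
        (V : ∀ k, Matrix (Fin (N k)) (Fin (rg (k - 1))) 𝔽)
        (D : ∀ k, Matrix (Fin (N k)) (Fin (N k)) 𝔽)
        (P : ∀ k, Matrix (Fin (N k)) (Fin (rh (k - 1))) 𝔽)
        (R : ∀ j, Matrix (Fin (rh (j + 1))) (Fin (rh j)) 𝔽)
        (Q : ∀ k, Matrix (Fin (N k)) (Fin (rh k)) 𝔽),
      IsSSSRep N A rg rh U W V D P R Q ∧
        ∀ c : ℕ, c < n - 1 →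
          rh c = (lowerHankelBlock N A c).rank ∧ rg c = (upperHankelBlock N A c).rank) ∧
    ∀ r : ℕ, (∀ S : Finset (Fin n), (blockHankel N A S).rank ≤ r * lineBorder n S) →
      ∃ (rg rh : ℕ → ℕ)
        (U : ∀ k, Matrix (Fin (N k)) (Fin (rg k)) 𝔽)
        (W : ∀ j, Matrix (Fin (rg j)) (Fin (rg (j + 1))) 𝔽)
        (V : ∀ k, Matrix (Fin (N k)) (Fin (rg (k - 1))) 𝔽)
        (D : ∀ k, Matrix (Fin (N k)) (Fin (N k)) 𝔽)
        (P : ∀ k, Matrix (Fin (N k)) (Fin (rh (k - 1))) 𝔽)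
        (R : ∀ j, Matrix (Fin (rh (j + 1))) (Fin (rh j)) 𝔽)
        (Q : ∀ k, Matrix (Fin (N k)) (Fin (rh k)) 𝔽),
      IsSSSRep N A rg rh U W V D P R Q ∧
        ∀ c : ℕ, c < n - 1 → rh c ≤ r ∧ rg c ≤ r := by
  obtain ⟨U, W, V, D, P, R, Q, h⟩ := exists_sss_rep_rank N A
  refine ⟨⟨fun c => (upperHankelBlock N A c).rank, fun c => (lowerHankelBlock N A c).rank,
      U, W, V, D, P, R, Q, h, fun c _ => ⟨rfl, rfl⟩⟩,
    fun r hr => ⟨fun c => (upperHankelBlock N A c).rank,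
      fun c => (lowerHankelBlock N A c).rank, U, W, V, D, P, R, Q, h, fun c hc => ⟨?_, ?_⟩⟩⟩
  · refine (rank_lowerHankelBlock N A c).trans_le ?_
    simpa only [lineBorder_initial hc, mul_one] using
      hr (Finset.univ.filter fun k : Fin n => (k : ℕ) ≤ c)
  · refine (rank_upperHankelBlock N A c).trans_le ?_
    simpa only [lineBorder_compl, lineBorder_initial hc, mul_one] using
      hr (Finset.univ.filter fun k : Fin n => (k : ℕ) ≤ c)ᶜ
end

section
/- Let A and B be block matrices over a field 𝔽 with the same block structure (n block rows/columns, block sizes N), admitting SSS representations with dimensions (r^h_{A,i}, r^g_{A,i}) and (r^h_{B,i}, r^g_{B,i}) respectively. Then C = A + B admits an SSS representation whose dimensions satisfy r^h_{C,i} ≤ r^h_{A,i} + r^h_{B,i} and r^g_{C,i} ≤ r^g_{A,i} + r^g_{B,i} for all 1 ≤ i ≤ n−1. -/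
open Matrix

variable {𝔽 : Type*} [Field 𝔽]

/-- Two matrices with the same rows, side by side, with columns indexed by `Fin (a + b)`. -/
def finFromCols {m : Type*} {a b : ℕ} (X : Matrix m (Fin a) 𝔽) (Y : Matrix m (Fin b) 𝔽) :
    Matrix m (Fin (a + b)) 𝔽 :=
  (Matrix.fromCols X Y).submatrix id finSumFinEquiv.symm

/-- The block diagonal matrix with blocks `X` and `Y`, indexed by `Fin`. -/
def finDiagBlocks {a b c d : ℕ} (X : Matrix (Fin a) (Fin c) 𝔽) (Y : Matrix (Fin b) (Fin d) 𝔽) :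
    Matrix (Fin (a + b)) (Fin (c + d)) 𝔽 :=
  (Matrix.fromBlocks X 0 0 Y).submatrix finSumFinEquiv.symm finSumFinEquiv.symm

theorem finDiagBlocks_one (a b : ℕ) :
    finDiagBlocks (1 : Matrix (Fin a) (Fin a) 𝔽) (1 : Matrix (Fin b) (Fin b) 𝔽) = 1 := by
  simp [finDiagBlocks]

theorem finDiagBlocks_mul {a b c d e f : ℕ}
    (X : Matrix (Fin a) (Fin c) 𝔽) (Y : Matrix (Fin b) (Fin d) 𝔽)
    (X' : Matrix (Fin c) (Fin e) 𝔽) (Y' : Matrix (Fin d) (Fin f) 𝔽) :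
    finDiagBlocks X Y * finDiagBlocks X' Y' = finDiagBlocks (X * X') (Y * Y') := by
  simp [finDiagBlocks, Matrix.submatrix_mul_equiv, Matrix.fromBlocks_multiply]

theorem finDiagBlocks_transpose {a b c d : ℕ}
    (X : Matrix (Fin a) (Fin c) 𝔽) (Y : Matrix (Fin b) (Fin d) 𝔽) :
    (finDiagBlocks X Y)ᵀ = finDiagBlocks Xᵀ Yᵀ := by
  simp [finDiagBlocks, Matrix.transpose_submatrix, Matrix.fromBlocks_transpose]

theorem finFromCols_mul_finDiagBlocks {m : Type*} {a b c d : ℕ}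
    (X : Matrix m (Fin a) 𝔽) (Y : Matrix m (Fin b) 𝔽)
    (X' : Matrix (Fin a) (Fin c) 𝔽) (Y' : Matrix (Fin b) (Fin d) 𝔽) :
    finFromCols X Y * finDiagBlocks X' Y' = finFromCols (X * X') (Y * Y') := by
  simp [finFromCols, finDiagBlocks, Matrix.submatrix_mul_equiv, Matrix.fromCols_mul_fromBlocks]

theorem finFromCols_mul_transpose {m m' : Type*} {a b : ℕ}
    (X : Matrix m (Fin a) 𝔽) (Y : Matrix m (Fin b) 𝔽)
    (X' : Matrix m' (Fin a) 𝔽) (Y' : Matrix m' (Fin b) 𝔽) :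
    finFromCols X Y * (finFromCols X' Y')ᵀ = X * X'ᵀ + Y * Y'ᵀ := by
  simp [finFromCols, Matrix.transpose_submatrix, Matrix.submatrix_mul_equiv,
    Matrix.transpose_fromCols, Matrix.fromCols_mul_fromRows]

theorem sssChainAux_finDiagBlocks (r s : ℕ → ℕ)
    (W : ∀ j, Matrix (Fin (r j)) (Fin (r (j + 1))) 𝔽)
    (W' : ∀ j, Matrix (Fin (s j)) (Fin (s (j + 1))) 𝔽) (k d : ℕ) :
    sssChainAux (fun j => r j + s j) (fun j => finDiagBlocks (W j) (W' j)) k d =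
      finDiagBlocks (sssChainAux r W k d) (sssChainAux s W' k d) := by
  induction d with
  | zero => exact (finDiagBlocks_one _ _).symm
  | succ d ih =>
    simp only [sssChainAux, ih]
    exact finDiagBlocks_mul _ _ _ _

theorem sssChain_finDiagBlocks (r s : ℕ → ℕ)
    (W : ∀ j, Matrix (Fin (r j)) (Fin (r (j + 1))) 𝔽)
    (W' : ∀ j, Matrix (Fin (s j)) (Fin (s (j + 1))) 𝔽) {k l : ℕ} (h : k ≤ l) :
    sssChain (fun j => r j + s j) (fun j => finDiagBlocks (W j) (W' j)) k l =
      finDiagBlocks (sssChain r W k l) (sssChain s W' k l) := by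
  obtain ⟨d, rfl⟩ := Nat.exists_eq_add_of_le h
  simp only [sssChain_add, sssChainAux_finDiagBlocks]

/-- If `A` and `B` admit SSS representations with dimensions `(rhA, rgA)` and `(rhB, rgB)`, then `A + B` admits an SSS representation whose dimensions satisfy `rhC c ≤ rhA c + rhB c` and `rgC c ≤ rgA c + rgB c` at every cut. -/
theorem sss_add {n : ℕ} (N : ℕ → ℕ)
    (A B : Matrix ((k : Fin n) × Fin (N k)) ((k : Fin n) × Fin (N k)) 𝔽)
    (rgA rhA rgB rhB : ℕ → ℕ)
    (UA : ∀ k, Matrix (Fin (N k)) (Fin (rgA k)) 𝔽)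
    (WA : ∀ j, Matrix (Fin (rgA j)) (Fin (rgA (j + 1))) 𝔽)
    (VA : ∀ k, Matrix (Fin (N k)) (Fin (rgA (k - 1))) 𝔽)
    (DA : ∀ k, Matrix (Fin (N k)) (Fin (N k)) 𝔽)
    (PA : ∀ k, Matrix (Fin (N k)) (Fin (rhA (k - 1))) 𝔽)
    (RA : ∀ j, Matrix (Fin (rhA (j + 1))) (Fin (rhA j)) 𝔽)
    (QA : ∀ k, Matrix (Fin (N k)) (Fin (rhA k)) 𝔽)
    (hA : IsSSSRep N A rgA rhA UA WA VA DA PA RA QA)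
    (UB : ∀ k, Matrix (Fin (N k)) (Fin (rgB k)) 𝔽)
    (WB : ∀ j, Matrix (Fin (rgB j)) (Fin (rgB (j + 1))) 𝔽)
    (VB : ∀ k, Matrix (Fin (N k)) (Fin (rgB (k - 1))) 𝔽)
    (DB : ∀ k, Matrix (Fin (N k)) (Fin (N k)) 𝔽)
    (PB : ∀ k, Matrix (Fin (N k)) (Fin (rhB (k - 1))) 𝔽)
    (RB : ∀ j, Matrix (Fin (rhB (j + 1))) (Fin (rhB j)) 𝔽)
    (QB : ∀ k, Matrix (Fin (N k)) (Fin (rhB k)) 𝔽)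
    (hB : IsSSSRep N B rgB rhB UB WB VB DB PB RB QB) :
    ∃ (rgC rhC : ℕ → ℕ)
      (UC : ∀ k, Matrix (Fin (N k)) (Fin (rgC k)) 𝔽)
      (WC : ∀ j, Matrix (Fin (rgC j)) (Fin (rgC (j + 1))) 𝔽)
      (VC : ∀ k, Matrix (Fin (N k)) (Fin (rgC (k - 1))) 𝔽)
      (DC : ∀ k, Matrix (Fin (N k)) (Fin (N k)) 𝔽)
      (PC : ∀ k, Matrix (Fin (N k)) (Fin (rhC (k - 1))) 𝔽)
      (RC : ∀ j, Matrix (Fin (rhC (j + 1))) (Fin (rhC j)) 𝔽)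
      (QC : ∀ k, Matrix (Fin (N k)) (Fin (rhC k)) 𝔽),
      IsSSSRep N (A + B) rgC rhC UC WC VC DC PC RC QC ∧
        ∀ c : ℕ, c < n - 1 →
          rhC c ≤ rhA c + rhB c ∧ rgC c ≤ rgA c + rgB c := by
  obtain ⟨hA_diag, hA_upper, hA_lower⟩ := hA
  obtain ⟨hB_diag, hB_upper, hB_lower⟩ := hB
  refine ⟨fun c => rgA c + rgB c, fun c => rhA c + rhB c,
    fun k => finFromCols (UA k) (UB k), fun j => finDiagBlocks (WA j) (WB j),
    fun k => finFromCols (VA k) (VB k), fun k => DA k + DB k,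
    fun k => finFromCols (PA k) (PB k), fun j => finDiagBlocks (RA j) (RB j),
    fun k => finFromCols (QA k) (QB k), ⟨?_, ?_, ?_⟩, fun c _ => ⟨le_rfl, le_rfl⟩⟩
  · intro k i j
    simp only [Matrix.add_apply, hA_diag, hB_diag]
  · intro k l h i j
    rw [sssChain_finDiagBlocks _ _ _ _ (Nat.le_sub_one_of_lt h), finFromCols_mul_finDiagBlocks,
      finFromCols_mul_transpose, Matrix.add_apply, Matrix.add_apply, hA_upper k l h,
      hB_upper k l h]
  · intro k l h i j
    simp only [finDiagBlocks_transpose]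
    rw [sssChain_finDiagBlocks rhA rhB (fun j => (RA j)ᵀ) (fun j => (RB j)ᵀ)
        (Nat.le_sub_one_of_lt h), finDiagBlocks_transpose, finFromCols_mul_finDiagBlocks,
      finFromCols_mul_transpose, Matrix.add_apply, Matrix.add_apply, hA_lower k l h,
      hB_lower k l h]
end

section
/- Let (A,G) have a DV representation A = 𝐃 + Z_G[𝐔](I − Z_G[𝐖])⁻¹𝐕ᵀ with state dimensions r : V → ℕ, and set r̄ = max over v ∈ V of r_v. Then (A,G) is GIRS-2r̄: for every subset S ⊆ V, rank(A_{S̄,S}) ≤ 2·r̄·ρ(S). -/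
open Matrix

variable {𝔽 : Type*} [Field 𝔽] {V : Type*} [Fintype V] [DecidableEq V]

/-- The block operator `Z_G[·]`: the block matrix whose `(v,w)` block is `W v w` if `{v,w}`
is an edge of `G` and `0` otherwise. -/
def ZG (G : SimpleGraph V) [DecidableRel G.Adj] {a b : V → ℕ}
    (W : ∀ v w : V, Matrix (Fin (a v)) (Fin (b w)) 𝔽) :
    Matrix ((v : V) × Fin (a v)) ((v : V) × Fin (b v)) 𝔽 :=
  Matrix.of fun p q => if G.Adj p.1 q.1 then W p.1 q.1 p.2 q.2 else 0

/-- The vertices incident to an edge of `G` with exactly one endpoint in `S`. -/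
def borderVertices (G : SimpleGraph V) [DecidableRel G.Adj] (S : Finset V) : Finset V :=
  Finset.univ.filter fun v => ∃ w, G.Adj v w ∧ (v ∈ S ↔ w ∉ S)

theorem card_borderVertices_le (G : SimpleGraph V) [DecidableRel G.Adj] (S : Finset V) :
    (borderVertices G S).card ≤ 2 * borderEdges G S := by
  unfold borderEdges
  set E := Finset.univ.filter fun p : V × V => G.Adj p.1 p.2 ∧ p.1 ∉ S ∧ p.2 ∈ S with hE
  have hsub : borderVertices G S ⊆ E.image Prod.fst ∪ E.image Prod.snd := by
    intro v hv
    obtain ⟨w, hvw, hS⟩ := (Finset.mem_filter.mp hv).2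
    rw [Finset.mem_union, Finset.mem_image, Finset.mem_image]
    by_cases hvS : v ∈ S
    · exact Or.inr ⟨(w, v), by simp [hE, hvw.symm, hS.mp hvS, hvS], rfl⟩
    · exact Or.inl ⟨(v, w), by simpa [hE, hvw, hvS] using hS, rfl⟩
  calc (borderVertices G S).card ≤ (E.image Prod.fst ∪ E.image Prod.snd).card :=
        Finset.card_le_card hsub
    _ ≤ (E.image Prod.fst).card + (E.image Prod.snd).card := Finset.card_union_le _ _
    _ ≤ 2 * E.card := by
        have h₁ : (E.image Prod.fst).card ≤ E.card := Finset.card_image_le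
        have h₂ : (E.image Prod.snd).card ≤ E.card := Finset.card_image_le
        omega

theorem card_sigma_fin_mem_le (r : V → ℕ) (B : Finset V) :
    Fintype.card {p : (v : V) × Fin (r v) // p.1 ∈ B} ≤ B.card * Finset.univ.sup r := by
  have hcard : Fintype.card {p : (v : V) × Fin (r v) // p.1 ∈ B} = ∑ v ∈ B, r v := by
    rw [Fintype.card_of_subtype (B.sigma fun v => (Finset.univ : Finset (Fin (r v))))
      (by simp), Finset.card_sigma]
    simp
  rw [hcard, ← smul_eq_mul]
  exact Finset.sum_le_card_nsmul _ _ _ fun v _ => Finset.le_sup (Finset.mem_univ v)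

/-- A column-selected matrix acts as the full matrix on the extension by zero. -/
theorem submatrix_val_mulVec {l m n : Type*} [Fintype n] (P : n → Prop) [DecidablePred P]
    (M : Matrix m n 𝔽) (e : l → m) (x : {j // P j} → 𝔽) :
    M.submatrix e Subtype.val *ᵥ x =
      (M *ᵥ fun j => if h : P j then x ⟨j, h⟩ else 0) ∘ e := by
  ext i
  simp only [mulVec, dotProduct, submatrix_apply, Function.comp_apply]
  rw [← Fintype.sum_subtype_add_sum_subtype P]
  have hin : ∀ j : {j // P j}, M (e i) j * (if h : P j then x ⟨j, h⟩ else 0) =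
      M (e i) j * x j := fun j => by simp [j.2]
  have hout : ∀ j : {j // ¬ P j}, M (e i) j * (if h : P j then x ⟨j, h⟩ else 0) = 0 :=
    fun j => by simp [j.2]
  simp only [hin, hout, Finset.sum_const_zero, add_zero]

theorem rank_le_rank_of_ker_le {l m n : Type*} [Fintype n] [Fintype m] [Fintype l]
    (M : Matrix m n 𝔽) (K : Matrix l n 𝔽) (h : ∀ x, K *ᵥ x = 0 → M *ᵥ x = 0) :
    M.rank ≤ K.rank := by
  have hker : LinearMap.ker K.mulVecLin ≤ LinearMap.ker M.mulVecLin := fun x hx => h x hx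
  have hle := Submodule.finrank_mono hker
  have hM := M.mulVecLin.finrank_range_add_finrank_ker
  have hK := K.mulVecLin.finrank_range_add_finrank_ker
  unfold Matrix.rank
  omega

/-- A row of `Z_G` only sees the values of a vector on adjacent blocks. -/
theorem ZG_mulVec_congr (G : SimpleGraph V) [DecidableRel G.Adj] {a b : V → ℕ}
    (W : ∀ v w : V, Matrix (Fin (a v)) (Fin (b w)) 𝔽) {x y : (v : V) × Fin (b v) → 𝔽}
    (p : (v : V) × Fin (a v)) (h : ∀ q : (v : V) × Fin (b v), G.Adj p.1 q.1 → x q = y q) :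
    (ZG G W *ᵥ x) p = (ZG G W *ᵥ y) p := by
  refine Finset.sum_congr rfl fun q _ => ?_
  by_cases hpq : G.Adj p.1 q.1
  · rw [h q hpq]
  · simp [ZG, hpq]

/-- If the input is supported on `S` and the state vanishes on the border vertices, then
the state vanishes outside `S`. -/
theorem state_eq_zero_of_border (G : SimpleGraph V) [DecidableRel G.Adj] {r : V → ℕ}
    (W : ∀ v w : V, Matrix (Fin (r v)) (Fin (r w)) 𝔽) (hW : IsUnit (1 - ZG G W))
    (S : Finset V) (s : (v : V) × Fin (r v) → 𝔽)
    (hin : ∀ p : (v : V) × Fin (r v), p.1 ∉ S → ((1 - ZG G W) *ᵥ s) p = 0)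
    (hs : ∀ p : (v : V) × Fin (r v), p.1 ∈ borderVertices G S → s p = 0)
    (p : (v : V) × Fin (r v)) (hp : p.1 ∉ S) : s p = 0 := by
  let t : (v : V) × Fin (r v) → 𝔽 := fun q => if q.1 ∈ S then 0 else s q
  have ht : (1 - ZG G W) *ᵥ t = 0 := by
    ext q
    by_cases hq : q.1 ∈ S
    · have h0 : (ZG G W *ᵥ t) q = (ZG G W *ᵥ 0) q := ZG_mulVec_congr G W q fun u hu => by
        by_cases huS : u.1 ∈ S
        · simp [t, huS]
        · have : s u = 0 := hs u <| by
            simp only [borderVertices, Finset.mem_filter, Finset.mem_univ, true_and]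
            exact ⟨q.1, hu.symm, by simp [hq, huS]⟩
          simp [t, this]
      simp [sub_mulVec, h0, t, hq]
    · have h0 : (ZG G W *ᵥ t) q = (ZG G W *ᵥ s) q := ZG_mulVec_congr G W q fun u hu => by
        by_cases huS : u.1 ∈ S
        · have : s u = 0 := hs u <| by
            simp only [borderVertices, Finset.mem_filter, Finset.mem_univ, true_and]
            exact ⟨q.1, hu.symm, by simp [hq, huS]⟩
          simp [t, this]
        · simp [t, huS]
      have := hin q hq
      simpa [sub_mulVec, h0, t, hq] using this
  have ht0 : t = 0 := mulVec_injective_of_isUnit hW (by rw [ht, mulVec_zero])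
  simpa [t, hp] using congrFun ht0 p

/-- If `(A, G)` has a DV representation
`A = 𝐃 + Z_G[𝐔] (I - Z_G[𝐖])⁻¹ 𝐕ᵀ` with state dimensions `r`, and `r̄ = max_v r v`, then
`(A, G)` is GIRS-`2r̄`: `rank(A_{S̄,S}) ≤ 2 r̄ ρ(S)` for every `S ⊆ V`. -/
theorem dv_isGIRS (G : SimpleGraph V) [DecidableRel G.Adj] (N r : V → ℕ)
    (D : ∀ v, Matrix (Fin (N v)) (Fin (N v)) 𝔽)
    (Vf : ∀ v, Matrix (Fin (N v)) (Fin (r v)) 𝔽)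
    (W : ∀ v w : V, Matrix (Fin (r v)) (Fin (r w)) 𝔽)
    (U : ∀ v w : V, Matrix (Fin (N v)) (Fin (r w)) 𝔽)
    (hW : IsUnit (1 - ZG G W))
    (A : Matrix ((v : V) × Fin (N v)) ((v : V) × Fin (N v)) 𝔽)
    (hA : A = Matrix.blockDiagonal' D +
      ZG G U * (1 - ZG G W)⁻¹ * (Matrix.blockDiagonal' Vf)ᵀ)
    (S : Finset V) :
    (hankelBlock A S).rank ≤ 2 * Finset.univ.sup r * borderEdges G S := by
  let M := (1 - ZG G W)⁻¹ * (Matrix.blockDiagonal' Vf)ᵀ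
  let K : Matrix {p : (v : V) × Fin (r v) // p.1 ∈ borderVertices G S}
      {p : (v : V) × Fin (N v) // p.1 ∈ S} 𝔽 := M.submatrix Subtype.val Subtype.val
  have hH : hankelBlock A S = (ZG G U * M).submatrix Subtype.val Subtype.val := by
    ext i j
    have hij : i.1.1 ≠ j.1.1 := fun h => i.2 (h ▸ j.2)
    simp [hankelBlock, hA, M, blockDiagonal'_apply, hij, Matrix.mul_assoc]
  have hker : ∀ x, K *ᵥ x = 0 → hankelBlock A S *ᵥ x = 0 := by
    intro x hx
    rw [submatrix_val_mulVec fun q : (v : V) × Fin (N v) => q.1 ∈ S] at hx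
    rw [hH, submatrix_val_mulVec fun q : (v : V) × Fin (N v) => q.1 ∈ S, ← mulVec_mulVec]
    set y : (v : V) × Fin (N v) → 𝔽 := fun j => if h : j.1 ∈ S then x ⟨j, h⟩ else 0 with hy
    have hborder : ∀ p : (v : V) × Fin (r v), p.1 ∈ borderVertices G S → (M *ᵥ y) p = 0 :=
      fun p hp => congrFun hx ⟨p, hp⟩
    have hout := state_eq_zero_of_border G W hW S (M *ᵥ y) (fun p hp => by
      rw [mulVec_mulVec, mul_nonsing_inv_cancel_left _ _ ((isUnit_iff_isUnit_det _).mp hW)]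
      refine Finset.sum_eq_zero fun q _ => ?_
      by_cases hq : q.1 ∈ S
      · have hqp : q.1 ≠ p.1 := fun h => hp (h ▸ hq)
        simp [blockDiagonal'_apply, hqp]
      · simp [hy, hq]) hborder
    ext i
    refine (ZG_mulVec_congr G U (y := 0) i.1 fun q hq => ?_).trans (by simp)
    by_cases hqS : q.1 ∈ S
    · refine hborder q ?_
      simp only [borderVertices, Finset.mem_filter, Finset.mem_univ, true_and]
      exact ⟨i.1.1, hq.symm, by simp [hqS, i.2]⟩
    · exact hout q hqS
  calc (hankelBlock A S).rank ≤ K.rank := rank_le_rank_of_ker_le _ _ hker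
    _ ≤ Fintype.card {p : (v : V) × Fin (r v) // p.1 ∈ borderVertices G S} :=
        K.rank_le_card_height
    _ ≤ (borderVertices G S).card * Finset.univ.sup r := card_sigma_fin_mem_le r _
    _ ≤ 2 * borderEdges G S * Finset.univ.sup r :=
        Nat.mul_le_mul_right _ (card_borderVertices_le G S)
    _ = 2 * Finset.univ.sup r * borderEdges G S := by ring
end
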